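/- arXiv:1404.5435 — 6 statements merged into one kernel-verified Lean document; each statement's English description precedes it below -/
import Mathlib

section
/- Every Jacobi-Jordan algebra A over a field K satisfies the Jordan identity: (x·x)·(y·x) = ((x·x)·y)·x for all x, y ∈ A. In particular every Jacobi-Jordan algebra is a (commutative) Jordan algebra, in any characteristic. -/
/-- Every Jacobi-Jordan algebra satisfies the Jordan identity
`(x·x)·(y·x) = ((x·x)·y)·x`, in any characteristic. -/
theorem jacobiJordan_isJordan {K A : Type*} [Field K]
    [AddCommGroup A] [Module K A] (mul : A →ₗ[K] A →ₗ[K] A)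
    (comm : ∀ x y : A, mul x y = mul y x)
    (jacobi : ∀ x y z : A, mul x (mul y z) + mul y (mul z x) + mul z (mul x y) = 0) :
    ∀ x y : A, mul (mul x x) (mul y x) = mul (mul (mul x x) y) x := by
  intro x y
  -- Left multiplication by `x·x` is `-2 Lₓ²`, hence commutes with `Lₓ`.
  have sq_mul (z : A) : mul (mul x x) z = -(mul x (mul x z) + mul x (mul x z)) := by
    have h := jacobi x x z
    rw [comm z x, comm z (mul x x)] at h
    exact eq_neg_of_add_eq_zero_right h
  rw [comm (mul (mul x x) y) x, comm y x, sq_mul, sq_mul, map_neg, map_add]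
end

section
/- Let A be a commutative (possibly non-associative, non-unital) algebra over a field K of characteristic different from 2 and 3. If x·(x·x) = 0 for all x ∈ A, then A satisfies the Jacobi identity x·(y·z) + y·(z·x) + z·(x·y) = 0 for all x, y, z ∈ A. Hence the class of Jacobi-Jordan algebras coincides with the class of commutative nilalgebras of nilindex at most 3. -/
/-- A commutative algebra over a field of characteristic different from `2` and `3`
in which `x·(x·x) = 0` for all `x` satisfies the Jacobi identity.  Hence Jacobi-Jordan
algebras are exactly the commutative nilalgebras of nilindex at most `3`. -/
theorem comm_nilindex_three_jacobi {K A : Type*} [Field K]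
    (h2 : (2 : K) ≠ 0) (h3 : (3 : K) ≠ 0)
    [AddCommGroup A] [Module K A] (mul : A →ₗ[K] A →ₗ[K] A)
    (comm : ∀ x y : A, mul x y = mul y x)
    (cube : ∀ x : A, mul x (mul x x) = 0) :
    ∀ x y z : A, mul x (mul y z) + mul y (mul z x) + mul z (mul x y) = 0 := by
  intro x y z
  have linearized : (2 : K) • (mul x (mul y z) + mul y (mul z x) + mul z (mul x y)) =
      mul (x + y + z) (mul (x + y + z) (x + y + z)) - mul (x + y) (mul (x + y) (x + y))
        - mul (y + z) (mul (y + z) (y + z)) - mul (x + z) (mul (x + z) (x + z))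
        + mul x (mul x x) + mul y (mul y y) + mul z (mul z z) := by
    simp only [map_add, LinearMap.add_apply, comm z y, comm z x, comm y x, two_smul]
    abel
  simp only [cube, sub_zero, add_zero] at linearized
  exact (smul_eq_zero.mp linearized).resolve_left h2
end

section
/- Let A be a Jacobi-Jordan algebra over a field K of characteristic different from 2 and 3. Then A is power-associative: defining principal powers by x^1 = x and x^{i+1} = x·x^i, one has x^m · x^n = x^{m+n} for all x ∈ A and all positive integers m, n. (In particular x^k = 0 for all k ≥ 3 and (x·x)·(x·x) = 0.) -/
/-- Principal powers of an element: `x^1 = x`, `x^(i+1) = x·x^i`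
(the value at `0` is irrelevant and set to `0`). -/
def principalPow {K A : Type*} [Field K] [AddCommGroup A] [Module K A]
    (mul : A →ₗ[K] A →ₗ[K] A) (x : A) : ℕ → A
  | 0 => 0
  | 1 => x
  | n + 2 => mul x (principalPow mul x (n + 1))

theorem principalPow_succ {K A : Type*} [Field K] [AddCommGroup A] [Module K A]
    (mul : A →ₗ[K] A →ₗ[K] A) (x : A) {n : ℕ} (hn : 1 ≤ n) :
    principalPow mul x (n + 1) = mul x (principalPow mul x n) := by
  obtain ⟨n, rfl⟩ := Nat.exists_eq_add_of_le' hn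
  rfl

theorem principalPow_eq_zero_of_cube_eq_zero {K A : Type*} [Field K] [AddCommGroup A]
    [Module K A] (mul : A →ₗ[K] A →ₗ[K] A) {x : A} (hx : mul x (mul x x) = 0) {k : ℕ}
    (hk : 3 ≤ k) : principalPow mul x k = 0 := by
  induction k, hk using Nat.le_induction with
  | base => exact hx
  | succ k hk ih => rw [principalPow_succ mul x (by omega), ih, map_zero]

/-- A Jacobi-Jordan algebra over a field of characteristic different from `2` and `3`
is power-associative: `x^m · x^n = x^(m+n)` for all positive integers `m, n`.
In particular `x^k = 0` for all `k ≥ 3`, and `(x·x)·(x·x) = 0`. -/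
theorem jacobiJordan_powerAssociative {K A : Type*} [Field K]
    (h2 : (2 : K) ≠ 0) (h3 : (3 : K) ≠ 0)
    [AddCommGroup A] [Module K A] (mul : A →ₗ[K] A →ₗ[K] A)
    (comm : ∀ x y : A, mul x y = mul y x)
    (jacobi : ∀ x y z : A, mul x (mul y z) + mul y (mul z x) + mul z (mul x y) = 0) :
    (∀ (x : A) (m n : ℕ), 1 ≤ m → 1 ≤ n →
      mul (principalPow mul x m) (principalPow mul x n) = principalPow mul x (m + n)) ∧
    (∀ (x : A) (k : ℕ), 3 ≤ k → principalPow mul x k = 0) ∧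
    (∀ x : A, mul (mul x x) (mul x x) = 0) := by
  have cube (x : A) : mul x (mul x x) = 0 := by
    have h : (3 : K) • mul x (mul x x) = 0 := by
      rw [← jacobi x x x]
      module
    exact (smul_eq_zero.mp h).resolve_left h3
  have pow_zero (x : A) (k : ℕ) (hk : 3 ≤ k) : principalPow mul x k = 0 :=
    principalPow_eq_zero_of_cube_eq_zero mul (cube x) hk
  have sq_sq (x : A) : mul (mul x x) (mul x x) = 0 := by
    simpa [cube x, comm (mul x x) x] using jacobi x x (mul x x)
  refine ⟨fun x m n hm hn => ?_, pow_zero, sq_sq⟩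
  obtain rfl | hm := hm.eq_or_lt
  · rw [add_comm, principalPow_succ mul x hn]
    rfl
  obtain rfl | hn := hn.eq_or_lt
  · rw [principalPow_succ mul x hm.le, comm]
    rfl
  rw [pow_zero x (m + n) (by omega)]
  obtain rfl | hm := (Nat.succ_le_of_lt hm).eq_or_lt
  · obtain rfl | hn := (Nat.succ_le_of_lt hn).eq_or_lt
    · exact sq_sq x
    · rw [pow_zero x n hn, map_zero]
  · rw [pow_zero x m hm, map_zero, LinearMap.zero_apply]
end

section
/- Every finite-dimensional Jacobi-Jordan algebra A over a field K of characteristic different from 2 and 3 is nilpotent: there exists a positive integer k such that every product of k elements of A, with any placement of parentheses, is zero. -/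
/-- `IsProdOfLength mul k a` means `a` is a product of `k` elements of the algebra,
with some placement of parentheses. -/
inductive IsProdOfLength {K A : Type*} [Field K] [AddCommGroup A] [Module K A]
    (mul : A →ₗ[K] A →ₗ[K] A) : ℕ → A → Prop
  | single (x : A) : IsProdOfLength mul 1 x
  | mul {m n : ℕ} {x y : A} : IsProdOfLength mul m x → IsProdOfLength mul n y →
      IsProdOfLength mul (m + n) (mul x y)

section

variable {K A : Type*} [Field K] [AddCommGroup A] [Module K A] (mul : A →ₗ[K] A →ₗ[K] A)

/-- The span of all left-normed products `b₁ (b₂ (⋯ (bₙ a)))` with `bᵢ ∈ B` and `a : A`. -/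
def leftPower (B : Submodule K A) (n : ℕ) : Submodule K A :=
  (Submodule.map₂ mul B)^[n] ⊤

theorem leftPower_succ (B : Submodule K A) (n : ℕ) :
    leftPower mul B (n + 1) = Submodule.map₂ mul B (leftPower mul B n) :=
  Function.iterate_succ_apply' _ _ _

variable {mul}

theorem mul_mem_leftPower {B : Submodule K A} {n : ℕ} {b v : A} (hb : b ∈ B)
    (hv : v ∈ leftPower mul B n) : mul b v ∈ leftPower mul B (n + 1) := by
  rw [leftPower_succ]
  exact Submodule.apply_mem_map₂ _ hb hv

theorem leftPower_antitone (B : Submodule K A) : Antitone (leftPower mul B) := by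
  refine antitone_nat_of_succ_le fun n => ?_
  induction n with
  | zero => exact le_top
  | succ n ih =>
    rw [leftPower_succ mul B (n + 1)]
    nth_rw 2 [leftPower_succ]
    exact Submodule.map₂_le_map₂_right ih

/-- In a commutative algebra, long products in any bracketing are left-normed products. -/
theorem IsProdOfLength.mem_leftPower_top (comm : ∀ x y : A, mul x y = mul y x) {k : ℕ} {a : A}
    (ha : IsProdOfLength mul k a) {n : ℕ} (hn : 2 ^ n ≤ k) : a ∈ leftPower mul ⊤ n := by
  induction ha generalizing n with
  | single x =>
    cases n with
    | zero => exact Submodule.mem_top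
    | succ n =>
      have := Nat.one_le_two_pow (n := n)
      omega
  | @mul p q x y _ _ ihx ihy =>
    cases n with
    | zero => exact Submodule.mem_top
    | succ n =>
      rcases le_or_gt (2 ^ n) p with hp | hp
      · rw [comm]
        exact mul_mem_leftPower Submodule.mem_top (ihx hp)
      · exact mul_mem_leftPower Submodule.mem_top (ihy (by omega))

theorem mul_mul_eq_of_jacobi (comm : ∀ x y : A, mul x y = mul y x)
    (jacobi : ∀ x y z : A, mul x (mul y z) + mul y (mul z x) + mul z (mul x y) = 0) (x y z : A) :
    mul x (mul y z) = -mul y (mul x z) - mul (mul x y) z := by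
  have h := jacobi x y z
  rw [comm z x, comm z (mul x y)] at h
  rw [eq_sub_iff_add_eq, eq_neg_iff_add_eq_zero, ← h]
  abel

theorem two_smul_mul_mul_self (comm : ∀ x y : A, mul x y = mul y x)
    (jacobi : ∀ x y z : A, mul x (mul y z) + mul y (mul z x) + mul z (mul x y) = 0) (x z : A) :
    (2 : K) • mul x (mul x z) = -mul (mul x x) z := by
  have h := mul_mul_eq_of_jacobi comm jacobi x x z
  rw [two_smul]
  nth_rw 1 [h]
  abel

theorem mul_mul_self_eq_zero (h3 : (3 : K) ≠ 0)
    (jacobi : ∀ x y z : A, mul x (mul y z) + mul y (mul z x) + mul z (mul x y) = 0) (x : A) :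
    mul x (mul x x) = 0 := by
  have h : (3 : K) • mul x (mul x x) = 0 := by
    rw [← jacobi x x x]
    module
  exact (smul_eq_zero.mp h).resolve_left h3

theorem mul_self_mul_mul_self_eq_zero (h3 : (3 : K) ≠ 0) (comm : ∀ x y : A, mul x y = mul y x)
    (jacobi : ∀ x y z : A, mul x (mul y z) + mul y (mul z x) + mul z (mul x y) = 0) (x : A) :
    mul (mul x x) (mul x x) = 0 := by
  have h := two_smul_mul_mul_self comm jacobi x (mul x x)
  rw [mul_mul_self_eq_zero h3 jacobi, map_zero, smul_zero] at h
  exact neg_eq_zero.mp h.symm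

/-- An element normalizing a subspace `B` preserves every left power of `B`. -/
theorem mul_mem_leftPower_of_normalizes (comm : ∀ x y : A, mul x y = mul y x)
    (jacobi : ∀ x y z : A, mul x (mul y z) + mul y (mul z x) + mul z (mul x y) = 0)
    {B : Submodule K A} {x : A} (hx : ∀ b ∈ B, mul x b ∈ B) (n : ℕ) {v : A}
    (hv : v ∈ leftPower mul B n) : mul x v ∈ leftPower mul B n := by
  induction n generalizing v with
  | zero => exact Submodule.mem_top
  | succ n ih =>
    suffices h : leftPower mul B (n + 1) ≤ (leftPower mul B (n + 1)).comap (mul x) from h hv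
    nth_rw 1 [leftPower_succ]
    refine Submodule.map₂_le.mpr fun b hb w hw => ?_
    rw [Submodule.mem_comap, mul_mul_eq_of_jacobi comm jacobi]
    exact sub_mem (neg_mem (mul_mem_leftPower hb (ih hw))) (mul_mem_leftPower (hx b hb) hw)

/-- Adjoining to `B` a normalizing element with square in `B` at most doubles the length of the
chain of left powers. -/
theorem leftPower_sup_span_singleton_le (h2 : (2 : K) ≠ 0) (comm : ∀ x y : A, mul x y = mul y x)
    (jacobi : ∀ x y z : A, mul x (mul y z) + mul y (mul z x) + mul z (mul x y) = 0)
    {B : Submodule K A} {x : A} (hx : ∀ b ∈ B, mul x b ∈ B) (hxx : mul x x ∈ B) (n : ℕ) :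
    leftPower mul (B ⊔ K ∙ x) (2 * n) ≤ leftPower mul B n := by
  induction n with
  | zero => exact le_top
  | succ n ih =>
    rw [show 2 * (n + 1) = 2 * n + 1 + 1 by ring, leftPower_succ, leftPower_succ]
    have anti := leftPower_antitone (mul := mul) B n.le_succ
    have hxv {m : ℕ} {v : A} := mul_mem_leftPower_of_normalizes (v := v) comm jacobi hx m
    have hsq {v : A} (hv : v ∈ leftPower mul B n) :
        mul x (mul x v) ∈ leftPower mul B (n + 1) := by
      rw [← Submodule.smul_mem_iff _ h2, two_smul_mul_mul_self comm jacobi]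
      exact neg_mem (mul_mem_leftPower hxx hv)
    refine Submodule.map₂_le.mpr fun c hc w hw => ?_
    suffices h : Submodule.map₂ mul (B ⊔ K ∙ x) (leftPower mul (B ⊔ K ∙ x) (2 * n)) ≤
        (leftPower mul B (n + 1)).comap (mul c) from h hw
    refine Submodule.map₂_le.mpr fun d hd v hv => ?_
    obtain ⟨b, hb, _, hs, rfl⟩ := Submodule.mem_sup.mp hc
    obtain ⟨s, rfl⟩ := Submodule.mem_span_singleton.mp hs
    obtain ⟨b', hb', _, ht, rfl⟩ := Submodule.mem_sup.mp hd
    obtain ⟨t, rfl⟩ := Submodule.mem_span_singleton.mp ht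
    have hv' := ih hv
    have hbv := mul_mem_leftPower hb' hv'
    simp only [Submodule.mem_comap, map_add, map_smul, LinearMap.add_apply, LinearMap.smul_apply]
    refine add_mem (add_mem ?_ ?_) (Submodule.smul_mem _ _ (add_mem ?_ ?_))
    · exact mul_mem_leftPower hb (anti hbv)
    · exact Submodule.smul_mem _ _ (hxv hbv)
    · exact mul_mem_leftPower hb (hxv hv')
    · exact Submodule.smul_mem _ _ (hsq hv')

/-- A proper subspace `B` acting nilpotently is normalized by some element outside it whose
square lies in `B`. -/
theorem exists_notMem_normalizes (h3 : (3 : K) ≠ 0)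
    (comm : ∀ x y : A, mul x y = mul y x)
    (jacobi : ∀ x y z : A, mul x (mul y z) + mul y (mul z x) + mul z (mul x y) = 0)
    {B : Submodule K A} (hB : B ≠ ⊤) {n : ℕ} (hn : leftPower mul B n = ⊥) :
    ∃ x ∉ B, (∀ b ∈ B, mul x b ∈ B) ∧ mul x x ∈ B := by
  obtain ⟨m, hm, hm'⟩ : ∃ m, ¬ leftPower mul B m ≤ B ∧ leftPower mul B (m + 1) ≤ B := by
    by_contra! h
    have key : ∀ m, ¬ leftPower mul B m ≤ B := fun m => by
      induction m with
      | zero => exact fun h0 => hB (top_le_iff.mp h0)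
      | succ m ih => exact h m ih
    exact key n (hn ▸ bot_le)
  obtain ⟨x, hxm, hxB⟩ := SetLike.not_le_iff_exists.mp hm
  have hx : ∀ b ∈ B, mul x b ∈ B := fun b hb => by
    rw [comm]
    exact hm' (mul_mem_leftPower hb hxm)
  by_cases hxx : mul x x ∈ B
  · exact ⟨x, hxB, hx, hxx⟩
  · refine ⟨mul x x, hxx, fun b hb => ?_, ?_⟩
    · rw [← neg_mem_iff, ← two_smul_mul_mul_self comm jacobi]
      exact B.smul_mem _ (hx _ (hx _ hb))
    · rw [mul_self_mul_mul_self_eq_zero h3 comm jacobi]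
      exact B.zero_mem

theorem exists_leftPower_top_eq_bot [FiniteDimensional K A] (h2 : (2 : K) ≠ 0) (h3 : (3 : K) ≠ 0)
    (comm : ∀ x y : A, mul x y = mul y x)
    (jacobi : ∀ x y z : A, mul x (mul y z) + mul y (mul z x) + mul z (mul x y) = 0) :
    ∃ n, leftPower mul ⊤ n = ⊥ := by
  obtain ⟨B, ⟨n, hn⟩, hmax⟩ := WellFounded.has_min
    (wellFounded_gt : WellFounded ((· > ·) : Submodule K A → Submodule K A → Prop))
    {B | ∃ n, leftPower mul B n = ⊥} ⟨⊥, 1, by rw [leftPower_succ, Submodule.map₂_bot_left]⟩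
  by_cases hB : B = ⊤
  · exact ⟨n, hB ▸ hn⟩
  obtain ⟨x, hxB, hx, hxx⟩ := exists_notMem_normalizes h3 comm jacobi hB hn
  refine absurd ?_ (hmax (B ⊔ K ∙ x) ⟨2 * n, ?_⟩)
  · rw [left_lt_sup, Submodule.span_singleton_le_iff_mem]
    exact hxB
  · exact le_bot_iff.mp
      ((leftPower_sup_span_singleton_le h2 comm jacobi hx hxx n).trans hn.le)

end

/-- Every finite-dimensional Jacobi-Jordan algebra over a field of characteristic
different from `2` and `3` is nilpotent: there is a positive integer `k` such that
every product of `k` elements, with any placement of parentheses, is zero. -/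
theorem jacobiJordan_nilpotent {K A : Type*} [Field K]
    (h2 : (2 : K) ≠ 0) (h3 : (3 : K) ≠ 0)
    [AddCommGroup A] [Module K A] [FiniteDimensional K A]
    (mul : A →ₗ[K] A →ₗ[K] A)
    (comm : ∀ x y : A, mul x y = mul y x)
    (jacobi : ∀ x y z : A, mul x (mul y z) + mul y (mul z x) + mul z (mul x y) = 0) :
    ∃ k : ℕ, 0 < k ∧ ∀ a : A, IsProdOfLength mul k a → a = 0 := by
  obtain ⟨n, hn⟩ := exists_leftPower_top_eq_bot h2 h3 comm jacobi
  refine ⟨2 ^ n, by positivity, fun a ha => ?_⟩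
  have h := ha.mem_leftPower_top comm le_rfl
  rwa [hn, Submodule.mem_bot] at h
end

section
/- Let A be a Jacobi-Jordan algebra over a field K of characteristic different from 2 and 3. Then (x·x)·(x·y) = 0 for all x, y ∈ A. -/
/-- In a Jacobi-Jordan algebra over a field of characteristic different from `2` and `3`,
`(x·x)·(x·y) = 0`. -/
theorem jacobiJordan_sq_mul_mul_eq_zero {K A : Type*} [Field K]
    (h2 : (2 : K) ≠ 0) (h3 : (3 : K) ≠ 0)
    [AddCommGroup A] [Module K A] (mul : A →ₗ[K] A →ₗ[K] A)
    (comm : ∀ x y : A, mul x y = mul y x)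
    (jacobi : ∀ x y z : A, mul x (mul y z) + mul y (mul z x) + mul z (mul x y) = 0) :
    ∀ x y : A, mul (mul x x) (mul x y) = 0 := by
  intro x y
  have cube : mul x (mul x x) = 0 := by
    have h : (3 : K) • mul x (mul x x) = 0 := by
      rw [← jacobi x x x]
      module
    exact (smul_eq_zero.mp h).resolve_left h3
  have sq_mul (z : A) : mul (mul x x) z = (-2 : K) • mul x (mul x z) := by
    have h := jacobi x x z
    rw [comm z x, comm z (mul x x)] at h
    rw [eq_neg_of_add_eq_zero_right h]
    module
  have mul_sq_mul : mul x (mul (mul x x) y) = mul (mul x x) (mul x y) := by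
    rw [sq_mul y, map_smul, sq_mul (mul x y)]
  have h : (2 : K) • mul (mul x x) (mul x y) = 0 := by
    have h := jacobi x (mul x x) y
    rw [cube, map_zero, add_zero, comm y x, mul_sq_mul] at h
    rw [two_smul, h]
  exact (smul_eq_zero.mp h).resolve_left h2
end

section
/- Let A be a Jacobi-Jordan algebra over a field K of characteristic different from 2 and 3. Then 2·((x·y)·(x·y)) + (x·x)·(y·y) = 0 for all x, y ∈ A. -/
/-- In a Jacobi-Jordan algebra over a field of characteristic different from `2` and `3`,
`2·((x·y)·(x·y)) + (x·x)·(y·y) = 0`. -/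
theorem jacobiJordan_identity4 {K A : Type*} [Field K]
    (h2 : (2 : K) ≠ 0) (h3 : (3 : K) ≠ 0)
    [AddCommGroup A] [Module K A] (mul : A →ₗ[K] A →ₗ[K] A)
    (comm : ∀ x y : A, mul x y = mul y x)
    (jacobi : ∀ x y z : A, mul x (mul y z) + mul y (mul z x) + mul z (mul x y) = 0) :
    ∀ x y : A, (2 : K) • mul (mul x y) (mul x y) + mul (mul x x) (mul y y) = 0 := by
  have sq_mul (x y : A) : mul x (mul y y) = -((2 : K) • mul y (mul x y)) := by
    have h := jacobi x y y
    rw [comm y x] at h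
    linear_combination (norm := module) h
  have sq_mul_sq (x y : A) : mul (mul x x) (mul y y) = (4 : K) • mul x (mul y (mul x y)) := by
    have h := jacobi x x (mul y y)
    rw [comm (mul y y) x, comm (mul y y) (mul x x), sq_mul, map_neg, map_smul] at h
    linear_combination (norm := module) h
  intro x y
  have h := jacobi x y (mul x y)
  have hx := sq_mul_sq x y
  have hy := sq_mul_sq y x
  rw [comm (mul x y) x] at h
  rw [comm (mul y y), comm y x] at hy
  refine (smul_eq_zero.mp ?_).resolve_left h2
  linear_combination (norm := module) (4 : K) • h + hx + hy
end
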